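/- Let l ≥ 2 be an integer and let G be a finite simple graph containing at least one induced copy of the cycle C_{2l+1}. Then (2(2l+1) · c(G, C_{2l+1}))^{2l} ≤ (2 · c(G, P_{2l}))^{2l+1}. -/

import Mathlib

open SimpleGraph

/-- Number of induced copies of `H` in `G`: vertex subsets of `G` whose induced
subgraph is isomorphic to `H`. -/
noncomputable def inducedCopies {V W : Type*} [Fintype V] [Fintype W]
    (G : SimpleGraph V) (H : SimpleGraph W) : ℕ :=
  {S : Finset V | Nonempty ((G.induce (S : Set V)) ≃g H)}.ncard

/-- The fractional independence number of a finite simple graph `H`. -/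
noncomputable def fracIndepNum {V : Type*} [Fintype V] (H : SimpleGraph V) : ℝ :=
  sSup {x : ℝ | ∃ ω : V → ℝ, (∀ v, 0 ≤ ω v ∧ ω v ≤ 1) ∧
    (∀ u v, H.Adj u v → ω u + ω v ≤ 1) ∧ x = ∑ v, ω v}

/-- The set of vertices adjacent to at least one vertex of `S`. -/
def finNbhd {V : Type*} [Fintype V] (H : SimpleGraph V) [DecidableRel H.Adj]
    (S : Finset V) : Finset V :=
  Finset.univ.filter (fun v => ∃ u ∈ S, H.Adj u v)

/-- Hölder's inequality for natural numbers, with all exponents equal. -/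
theorem sum_pow_card_le_mul_prod_sum {β ι : Type*} [Fintype ι] [Nonempty ι]
    (s : Finset β) (a : β → ℕ) (b : ι → β → ℕ) (c : ℕ)
    (h : ∀ x ∈ s, a x ^ Fintype.card ι ≤ c * ∏ i, b i x) :
    (∑ x ∈ s, a x) ^ Fintype.card ι ≤ c * ∏ i, ∑ x ∈ s, b i x := by
  set n := Fintype.card ι with hn_def
  have hn : n ≠ 0 := Fintype.card_ne_zero
  have hroot (y : ENNReal) : (y ^ (n : ℝ)⁻¹) ^ n = y := ENNReal.rpow_inv_natCast_pow hn y
  let _ : MeasurableSpace s := ⊤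
  have holder := ENNReal.lintegral_prod_norm_pow_le
    (μ := (MeasureTheory.Measure.count : MeasureTheory.Measure s)) (Finset.univ : Finset ι)
    (f := fun i x => (b i x : ENNReal)) (fun i _ => (measurable_of_finite _).aemeasurable)
    (p := fun _ => (n : ℝ)⁻¹) (by simp [← hn_def, hn]) (by intros; positivity)
  simp only [MeasureTheory.lintegral_count, tsum_fintype] at holder
  have hle : ∑ x : s, (a x : ENNReal) ≤
      (c : ENNReal) ^ (n : ℝ)⁻¹ * ∏ i, (∑ x : s, (b i x : ENNReal)) ^ (n : ℝ)⁻¹ := by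
    refine le_trans ?_ (mul_le_mul_right holder _)
    rw [Finset.mul_sum]
    refine Finset.sum_le_sum fun x _ => ?_
    rw [← ENNReal.pow_le_pow_left_iff hn, mul_pow, hroot, ← Finset.prod_pow]
    simp only [hroot]
    exact_mod_cast h x x.2
  have hpow := pow_le_pow_left' hle n
  rw [mul_pow, hroot, ← Finset.prod_pow] at hpow
  simp only [hroot] at hpow
  simp only [← Finset.sum_coe_sort s]
  exact_mod_cast hpow

open Classical in
/-- The discrete Loomis–Whitney inequality. -/
theorem card_pow_le_prod_card_image_removeNth {α : Type*} (n : ℕ)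
    (A : Finset (Fin (n + 1) → α)) (hA : A.Nonempty) :
    A.card ^ n ≤ ∏ i : Fin (n + 1), (A.image (Fin.removeNth i)).card := by
  induction n with
  | zero => simpa [Nat.one_le_iff_ne_zero] using hA.ne_empty
  | succ n ih =>
    let s := A.image (fun f => f 0)
    let slice (x : α) := (A.filter (fun f => f 0 = x)).image Fin.tail
    have tail_inj (x : α) (m : ℕ) (B : Finset (Fin (m + 1) → α)) :
        Set.InjOn Fin.tail (B.filter (fun f => f 0 = x) : Set (Fin (m + 1) → α)) := by
      intro f hf g hg hfg
      simp only [Finset.coe_filter, Set.mem_ofPred_eq] at hf hg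
      rw [← Fin.cons_self_tail f, ← Fin.cons_self_tail g, hf.2, hg.2, hfg]
    have card_A : A.card = ∑ x ∈ s, (slice x).card := by
      rw [Finset.card_eq_sum_card_image (fun f => f 0) A]
      exact Finset.sum_congr rfl fun x _ => (Finset.card_image_of_injOn (tail_inj x _ A)).symm
    have card_slice (x : α) : (slice x).card ≤ (A.image (Fin.removeNth 0)).card := by
      refine Finset.card_le_card ?_
      rw [show Fin.removeNth (α := fun _ => α) 0 = Fin.tail from funext Fin.removeNth_zero]
      exact Finset.image_subset_image (Finset.filter_subset _ _)
    have sum_slice (i : Fin (n + 1)) :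
        ∑ x ∈ s, ((slice x).image (Fin.removeNth i)).card ≤
          (A.image (Fin.removeNth i.succ)).card := by
      have maps : Set.MapsTo (fun g : Fin (n + 1) → α => g 0)
          (A.image (Fin.removeNth i.succ) : Set (Fin (n + 1) → α)) (s : Set α) := by
        intro g hg
        simp only [Finset.coe_image, Set.mem_image, Finset.mem_coe] at hg
        obtain ⟨f, hf, rfl⟩ := hg
        exact Finset.mem_image.2 ⟨f, hf, by simp [Fin.removeNth]⟩
      rw [Finset.card_eq_sum_card_fiberwise maps]
      refine Finset.sum_le_sum fun x _ => ?_
      refine le_trans (Finset.card_le_card ?_) (Finset.card_image_le (f := Fin.tail (α := fun _ => α)))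
      intro g hg
      simp only [slice, Finset.mem_image, Finset.mem_filter] at hg ⊢
      obtain ⟨_, ⟨f, ⟨hf, hx⟩, rfl⟩, rfl⟩ := hg
      refine ⟨Fin.removeNth i.succ f, ⟨⟨f, hf, rfl⟩, by simpa [Fin.removeNth] using hx⟩, ?_⟩
      ext j
      simp [Fin.removeNth, Fin.tail]
    have key := sum_pow_card_le_mul_prod_sum s (fun x => (slice x).card)
      (fun (i : Fin (n + 1)) x => ((slice x).image (Fin.removeNth i)).card)
      (A.image (Fin.removeNth 0)).card (by
        intro x hx
        rw [Fintype.card_fin, pow_succ, mul_comm]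
        refine Nat.mul_le_mul (card_slice x) (ih _ ?_)
        obtain ⟨f, hf, hfx⟩ := Finset.mem_image.1 hx
        exact ⟨_, Finset.mem_image_of_mem _ (Finset.mem_filter.2 ⟨hf, hfx⟩)⟩)
    rw [Fintype.card_fin, ← card_A] at key
    rw [Fin.prod_univ_succ]
    exact key.trans (Nat.mul_le_mul_left _ (Finset.prod_le_prod' fun i _ => sum_slice i))

/-- Every induced copy of `H` is the image of exactly `|Aut H|` embeddings. -/
theorem card_embedding_eq_inducedCopies_mul_card_aut {V W : Type*} [Fintype V] [Fintype W]
    (G : SimpleGraph V) (H : SimpleGraph W) :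
    Nat.card (H ↪g G) = inducedCopies G H * Nat.card (H ≃g H) := by
  let copies := {S : Finset V | Nonempty ((G.induce (S : Set V)) ≃g H)}
  let iso (S : copies) : H ≃g G.induce ((S : Finset V) : Set V) := S.2.some.symm
  let toEmb (p : copies × (H ≃g H)) : H ↪g G :=
    (SimpleGraph.Embedding.induce _).comp ((iso p.1).toEmbedding.comp p.2.toEmbedding)
  have toEmb_apply (p : copies × (H ≃g H)) (w : W) : toEmb p w = (iso p.1 (p.2 w) : V) := rfl
  have range_toEmb (p : copies × (H ≃g H)) : Set.range (toEmb p) = ((p.1 : Finset V) : Set V) := by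
    ext v
    constructor
    · rintro ⟨w, rfl⟩
      exact (iso p.1 (p.2 w)).2
    · intro hv
      exact ⟨p.2.symm ((iso p.1).symm ⟨v, hv⟩), by simp [toEmb_apply]⟩
  have hbij : Function.Bijective toEmb := by
    constructor
    · rintro ⟨S, φ⟩ ⟨T, ψ⟩ h
      obtain rfl : S = T := by
        have := range_toEmb (S, φ)
        rw [h, range_toEmb] at this
        exact Subtype.ext (Finset.coe_injective this.symm)
      refine Prod.ext rfl (RelIso.ext fun w => ?_)
      have := DFunLike.congr_fun h w
      exact (iso S).injective (Subtype.ext this)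
    · intro f
      classical
      let S : Finset V := Finset.univ.image f
      have hmem (w : W) : f w ∈ (S : Set V) := by simp [S]
      let e : W ≃ (S : Set V) := Equiv.ofBijective (fun w => ⟨f w, hmem w⟩)
        ⟨fun x y h => f.injective (congrArg Subtype.val h), fun ⟨v, hv⟩ => by
          obtain ⟨w, -, rfl⟩ := Finset.mem_image.1 (Finset.mem_coe.1 hv)
          exact ⟨w, rfl⟩⟩
      let E : H ≃g G.induce (S : Set V) := ⟨e, f.map_adj_iff⟩
      let T : copies := ⟨S, ⟨E.symm⟩⟩
      refine ⟨(T, E.trans (iso T).symm), RelEmbedding.ext fun w => ?_⟩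
      rw [toEmb_apply]
      change ((iso T ((iso T).symm (E w)) : (S : Set V)) : V) = f w
      rw [RelIso.apply_symm_apply]
      rfl
  rw [← Nat.card_eq_of_bijective _ hbij, Nat.card_prod]
  rfl

/-- The dihedral symmetries of a cycle. -/
theorem two_mul_le_card_aut_cycleGraph (n : ℕ) :
    2 * (n + 3) ≤ Nat.card (cycleGraph (n + 3) ≃g cycleGraph (n + 3)) := by
  let rot (a : Fin (n + 3)) : cycleGraph (n + 3) ≃g cycleGraph (n + 3) :=
    ⟨Equiv.addLeft a, by intro u v; simp [cycleGraph_adj]⟩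
  let refl (a : Fin (n + 3)) : cycleGraph (n + 3) ≃g cycleGraph (n + 3) :=
    ⟨Equiv.subLeft a, by intro u v; simp [cycleGraph_adj, or_comm]⟩
  let F : Bool × Fin (n + 3) → (cycleGraph (n + 3) ≃g cycleGraph (n + 3)) :=
    fun p => bif p.1 then rot p.2 else refl p.2
  have hneg : (1 : Fin (n + 3)) ≠ -1 := by
    intro h
    have h2 : (1 : Fin (n + 3)) + 1 = 0 := by nth_rw 1 [h]; exact neg_add_cancel 1
    have := congrArg Fin.val h2
    rw [Fin.val_add, Fin.val_one, Fin.val_zero, Nat.mod_eq_of_lt (by lia)] at this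
    lia
  have hF : Function.Injective F := by
    rintro ⟨b, x⟩ ⟨c, y⟩ h
    have h0 : F (b, x) 0 = F (c, y) 0 := by rw [h]
    have h1 : F (b, x) 1 = F (c, y) 1 := by rw [h]
    clear h
    cases b <;> cases c <;> simp_all [F, rot, refl, sub_eq_add_neg, hneg.symm]
  have : Finite (cycleGraph (n + 3) ≃g cycleGraph (n + 3)) :=
    Finite.of_injective _ DFunLike.coe_injective
  have := Nat.card_le_card_of_injective F hF
  simpa using this

theorem pathGraph_aut_eq_of_map_zero {m : ℕ} (φ : pathGraph (m + 1) ≃g pathGraph (m + 1))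
    (h0 : φ 0 = 0) (x : Fin (m + 1)) : φ x = x := by
  obtain ⟨k, hk⟩ := x
  induction k using Nat.strong_induction_on with
  | _ k ih =>
    rcases k with _ | _ | k
    · exact h0
    · have hadj := φ.map_adj_iff (v := (0 : Fin (m + 1))) (w := ⟨1, hk⟩)
      rw [h0] at hadj
      simp only [pathGraph_adj, Fin.ext_iff] at hadj ⊢
      simp at hadj
      lia
    · have h1 := ih k (by lia) (by lia)
      have h2 := ih (k + 1) (by lia) (by lia)
      have hadj := φ.map_adj_iff (v := ⟨k + 1, by lia⟩) (w := ⟨k + 1 + 1, hk⟩)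
      have hne : φ ⟨k + 1 + 1, hk⟩ ≠ φ ⟨k, by lia⟩ := fun h => by
        have := φ.injective h
        simp only [Fin.mk.injEq] at this
        lia
      rw [h1] at hne
      rw [h2] at hadj
      simp only [pathGraph_adj, Fin.ext_iff, ne_eq] at hadj hne ⊢
      lia

theorem pathGraph_aut_map_zero {m : ℕ} (φ : pathGraph (m + 1) ≃g pathGraph (m + 1)) :
    φ 0 = 0 ∨ φ 0 = Fin.last m := by
  by_contra! h
  obtain ⟨h0, hl⟩ := h
  have hpos : 0 < (φ 0).val := Fin.pos_iff_ne_zero.2 h0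
  have hlt : (φ 0).val < m := Fin.val_lt_last hl
  have hval (y : Fin (m + 1)) (hy : (pathGraph (m + 1)).Adj (φ 0) y) : (φ.symm y).val = 1 := by
    rw [← φ.apply_symm_apply y, φ.map_adj_iff, pathGraph_adj] at hy
    simp at hy
    lia
  have h1 := hval ⟨(φ 0).val - 1, by lia⟩ (by simp only [pathGraph_adj]; lia)
  have h2 := hval ⟨(φ 0).val + 1, by lia⟩ (by simp [pathGraph_adj])
  have := φ.symm.injective (Fin.ext (h1.trans h2.symm))
  simp only [Fin.mk.injEq] at this
  lia

theorem card_aut_pathGraph_le_two (m : ℕ) :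
    Nat.card (pathGraph (m + 1) ≃g pathGraph (m + 1)) ≤ 2 := by
  classical
  have hinj : Function.Injective
      (fun φ : pathGraph (m + 1) ≃g pathGraph (m + 1) => decide (φ 0 = 0)) := by
    intro φ ψ h
    have h0 : φ 0 = ψ 0 := by
      have := pathGraph_aut_map_zero φ
      have := pathGraph_aut_map_zero ψ
      simp only [decide_eq_decide] at h
      grind
    refine RelIso.ext fun x => ?_
    have := pathGraph_aut_eq_of_map_zero (φ.trans ψ.symm) (by simp [h0]) x
    simpa [RelIso.symm_apply_eq] using this
  simpa using Nat.card_le_card_of_injective _ hinj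

/-- Deleting the vertex `i` from a cycle leaves an induced path. -/
theorem exists_pathGraph_embedding_cycleGraph_avoiding {n : ℕ} (i : Fin (n + 1)) :
    ∃ e : pathGraph n ↪g cycleGraph (n + 1), ∀ j, e j ≠ i := by
  refine ⟨⟨⟨fun j => i + j.succ, fun x y h => by simpa using h⟩, ?_⟩, fun j h => ?_⟩
  · intro x y
    change (cycleGraph (n + 1)).Adj (i + x.succ) (i + y.succ) ↔ _
    simp only [cycleGraph_adj', add_sub_add_left_eq_sub, pathGraph_adj]
    have hx := x.2
    have hy := y.2
    rcases lt_trichotomy x.val y.val with h | h | h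
    · have h1 : (y.succ - x.succ).val = y.succ.val - x.succ.val :=
        Fin.sub_val_of_le (Fin.succ_le_succ_iff.2 h.le)
      have h2 : (x.succ - y.succ).val = n + 1 + x.succ.val - y.succ.val :=
        Fin.coe_sub_iff_lt.2 (Fin.succ_lt_succ_iff.2 h)
      simp only [Fin.val_succ] at h1 h2
      lia
    · obtain rfl := Fin.ext h
      simp
    · have h1 : (x.succ - y.succ).val = x.succ.val - y.succ.val :=
        Fin.sub_val_of_le (Fin.succ_le_succ_iff.2 h.le)
      have h2 : (y.succ - x.succ).val = n + 1 + y.succ.val - x.succ.val :=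
        Fin.coe_sub_iff_lt.2 (Fin.succ_lt_succ_iff.2 h)
      simp only [Fin.val_succ] at h1 h2
      lia
  · exact Fin.succ_ne_zero j (add_eq_left.1 h)

theorem card_cycleGraph_embedding_pow_le {V : Type*} [Fintype V] (G : SimpleGraph V) (n : ℕ)
    (hne : Nonempty (cycleGraph (n + 1) ↪g G)) :
    Nat.card (cycleGraph (n + 1) ↪g G) ^ n ≤ Nat.card (pathGraph n ↪g G) ^ (n + 1) := by
  classical
  have := Fintype.ofFinite (cycleGraph (n + 1) ↪g G)
  have := Fintype.ofFinite (pathGraph n ↪g G)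
  let A : Finset (Fin (n + 1) → V) :=
    Finset.univ.image (fun f : cycleGraph (n + 1) ↪g G => (f : Fin (n + 1) → V))
  let P : Finset (Fin n → V) :=
    Finset.univ.image (fun f : pathGraph n ↪g G => (f : Fin n → V))
  have hA : A.card = Nat.card (cycleGraph (n + 1) ↪g G) := by
    rw [Finset.card_image_of_injective _ DFunLike.coe_injective, Nat.card_eq_fintype_card,
      Finset.card_univ]
  have hP : P.card = Nat.card (pathGraph n ↪g G) := by
    rw [Finset.card_image_of_injective _ DFunLike.coe_injective, Nat.card_eq_fintype_card,
      Finset.card_univ]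
  have hproj (i : Fin (n + 1)) : (A.image (Fin.removeNth i)).card ≤ P.card := by
    obtain ⟨e, he⟩ := exists_pathGraph_embedding_cycleGraph_avoiding i
    choose r hr using fun j => Fin.exists_succAbove_eq (he j)
    have hr_surj : Function.Surjective r := Finite.surjective_of_injective fun x y h =>
      e.injective (by rw [← hr x, ← hr y, h])
    refine Finset.card_le_card_of_injOn (fun g => g ∘ r) ?_
      (hr_surj.injective_comp_right.injOn)
    intro g hg
    simp only [A, Finset.coe_image, Set.mem_image, true_and,
      exists_exists_eq_and, Finset.coe_univ, Set.mem_univ] at hg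
    obtain ⟨f, rfl⟩ := hg
    refine Finset.mem_coe.2 (Finset.mem_image.2 ⟨f.comp e, Finset.mem_univ _, ?_⟩)
    ext j
    simp [Fin.removeNth, hr]
  rw [← hA, ← hP]
  calc A.card ^ n ≤ ∏ i : Fin (n + 1), (A.image (Fin.removeNth i)).card :=
        card_pow_le_prod_card_image_removeNth n A (Finset.univ_nonempty.image _)
    _ ≤ ∏ _i : Fin (n + 1), P.card := Finset.prod_le_prod' fun i _ => hproj i
    _ = P.card ^ (n + 1) := by simp

theorem odd_cycle_vs_even_path (l : ℕ) (hl : 2 ≤ l) {V : Type*} [Fintype V]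
    (G : SimpleGraph V)
    (hpos : 0 < inducedCopies G (SimpleGraph.cycleGraph (2 * l + 1))) :
    (2 * (2 * l + 1) * inducedCopies G (SimpleGraph.cycleGraph (2 * l + 1))) ^ (2 * l) ≤
      (2 * inducedCopies G (SimpleGraph.pathGraph (2 * l))) ^ (2 * l + 1) := by
  have hcycle : 2 * (2 * l + 1) * inducedCopies G (cycleGraph (2 * l + 1)) ≤
      Nat.card (cycleGraph (2 * l + 1) ↪g G) := by
    rw [card_embedding_eq_inducedCopies_mul_card_aut, mul_comm]
    obtain ⟨m, hm⟩ : ∃ m, 2 * l + 1 = m + 3 := ⟨2 * l - 2, by lia⟩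
    rw [hm]
    exact Nat.mul_le_mul_left _ (two_mul_le_card_aut_cycleGraph m)
  have hpath : Nat.card (pathGraph (2 * l) ↪g G) ≤ 2 * inducedCopies G (pathGraph (2 * l)) := by
    rw [card_embedding_eq_inducedCopies_mul_card_aut, mul_comm]
    obtain ⟨m, hm⟩ : ∃ m, 2 * l = m + 1 := ⟨2 * l - 1, by lia⟩
    rw [hm]
    exact Nat.mul_le_mul_right _ (card_aut_pathGraph_le_two m)
  have hne : Nonempty (cycleGraph (2 * l + 1) ↪g G) :=
    (Nat.card_pos_iff.1 (lt_of_lt_of_le (by positivity) hcycle)).1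
  calc _ ≤ Nat.card (cycleGraph (2 * l + 1) ↪g G) ^ (2 * l) := Nat.pow_le_pow_left hcycle _
    _ ≤ Nat.card (pathGraph (2 * l) ↪g G) ^ (2 * l + 1) := card_cycleGraph_embedding_pow_le G _ hne
    _ ≤ _ := Nat.pow_le_pow_left hpath _
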